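/- Single-valuedness of the resolvent: let C be a nonempty closed convex subset of E and suppose f is in addition strictly convex. Let g : C × C → ℝ satisfy conditions (A1)–(A4). If x ∈ E and z, w ∈ C both satisfy the resolvent inequality with respect to x, i.e., g(z,y) + ⟨∇f(z) − ∇f(x), y − z⟩ ≥ 0 for all y ∈ C and g(w,y) + ⟨∇f(w) − ∇f(x), y − w⟩ ≥ 0 for all y ∈ C, then z = w. -/

import Mathlib

open Filter Topology

/-- The gradient inequality: a strictly convex function lies strictly above its tangents. -/
theorem StrictConvexOn.hasFDerivAt_apply_sub_lt
    {E : Type*} [NormedAddCommGroup E] [NormedSpace ℝ E] {f : E → ℝ} {f' : E →L[ℝ] ℝ} {z w : E}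
    (hf : StrictConvexOn ℝ Set.univ f) (hd : HasFDerivAt f f' z) (hne : z ≠ w) :
    f' (w - z) < f w - f z := by
  have hline : StrictConvexOn ℝ Set.univ (f ∘ AffineMap.lineMap (k := ℝ) z w) := by
    refine ⟨convex_univ, fun s _ t _ hst a b ha hb hab => ?_⟩
    have h := hf.2 (Set.mem_univ _) (Set.mem_univ _)
      ((AffineMap.lineMap_injective ℝ hne).ne hst) ha hb hab
    rwa [← Convex.combo_affine_apply hab] at h
  have hderiv : HasDerivAt (f ∘ AffineMap.lineMap (k := ℝ) z w) (f' (w - z)) 0 :=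
    HasFDerivAt.comp_hasDerivAt (0 : ℝ) (by simpa using hd) AffineMap.hasDerivAt_lineMap
  have h := hline.lt_slope_of_hasDerivAt (Set.mem_univ 0) (Set.mem_univ 1) one_pos hderiv
  simpa [slope_def_field] using h

/-- Single-valuedness of the resolvent: let `C` be a nonempty closed convex subset of
a reflexive space `E`, `f` strictly convex, and let `g : C × C → ℝ` satisfy
(A1)–(A4).  If `z, w ∈ C` both satisfy the resolvent inequality with respect to
`x ∈ E`, then `z = w`. -/
theorem resolvent_single_valued
    {E : Type*} [NormedAddCommGroup E] [NormedSpace ℝ E] [CompleteSpace E]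
    (hrefl : Function.Surjective (NormedSpace.inclusionInDoubleDual ℝ E))
    (f : E → ℝ) (f' : E → (E →L[ℝ] ℝ))
    (hconv : ConvexOn ℝ Set.univ f)
    (hstrict : StrictConvexOn ℝ Set.univ f)
    (hdiff : ∀ x : E, HasFDerivAt f (f' x) x)
    (C : Set E) (hCne : C.Nonempty) (hCclosed : IsClosed C) (hCconv : Convex ℝ C)
    (g : E → E → ℝ)
    (hA1 : ∀ x ∈ C, g x x = 0)
    (hA2 : ∀ x ∈ C, ∀ y ∈ C, g x y + g y x ≤ 0)
    (hA3 : ∀ x ∈ C, ∀ z ∈ C, ∀ y ∈ C,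
      limsup (fun t : ℝ => g (x + t • (z - x)) y) (𝓝[>] (0:ℝ)) ≤ g x y)
    (hA4 : ∀ x ∈ C, ConvexOn ℝ C (g x) ∧ LowerSemicontinuousOn (g x) C)
    (x : E) (z w : E) (hz : z ∈ C) (hw : w ∈ C)
    (hzres : ∀ y ∈ C, g z y + (f' z - f' x) (y - z) ≥ 0)
    (hwres : ∀ y ∈ C, g w y + (f' w - f' x) (y - w) ≥ 0) :
    z = w := by
  by_contra hne
  have hzw := hstrict.hasFDerivAt_apply_sub_lt (hdiff z) hne
  have hwz := hstrict.hasFDerivAt_apply_sub_lt (hdiff w) (Ne.symm hne)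
  have hz' := hzres w hw
  have hw' := hwres z hz
  have hmono := hA2 z hz w hw
  simp only [sub_apply, map_sub] at hzw hwz hz' hw'
  linarith
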